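/- Under the standing hypotheses, the four numbers a + 6d, a + 5d, a + 4d, a + 3d cannot consist of exactly two 2-dominated and two 3-dominated numbers: there do not exist nonnegative integers x > y and z > w such that the set {a + 6d, a + 5d, a + 4d, a + 3d} equals {2^n + 3^x, 2^n + 3^y, 3^m + 2^z, 3^m + 2^w}. -/

import Mathlib

/-- A power of `2` dividing `3 ^ s - 1` is at most `4 * s`. -/
lemma two_pow_le_of_dvd_three_pow_sub_one {k s : ℕ} (hs : 0 < s) (h : 2 ^ k ∣ 3 ^ s - 1) :
    2 ^ k ≤ 4 * s := by
  have h1 : 1 < 3 ^ s := Nat.one_lt_pow hs.ne' (by norm_num)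
  rcases Nat.even_or_odd s with he | ho
  · have hv := padicValNat.pow_two_sub_pow (x := 3) (y := 1) (by norm_num) (by norm_num)
      (by norm_num) hs.ne' he
    have h4 : padicValNat 2 (3 + 1) = 2 := by
      rw [show 3 + 1 = 2 ^ 2 by norm_num, padicValNat.prime_pow]
    have h2 : padicValNat 2 (3 - 1) = 1 := by
      rw [show 3 - 1 = 2 by norm_num, padicValNat.self (by norm_num)]
    rw [h4, h2, one_pow] at hv
    have hk : k ≤ padicValNat 2 (3 ^ s - 1) :=
      (padicValNat_dvd_iff_le (by omega)).1 h
    calc 2 ^ k ≤ 2 ^ (2 + padicValNat 2 s) := Nat.pow_le_pow_right (by norm_num) (by omega)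
      _ = 4 * 2 ^ padicValNat 2 s := by rw [pow_add]; norm_num
      _ ≤ 4 * s := Nat.mul_le_mul_left 4 (Nat.le_of_dvd hs pow_padicValNat_dvd)
  · obtain ⟨r, rfl⟩ := ho
    have hk : k < 2 := by
      by_contra! hk
      have h4 : 4 ∣ 3 ^ (2 * r + 1) - 1 := (pow_dvd_pow 2 hk).trans h
      have h9 : 3 ^ (2 * r + 1) % 4 = 3 := by
        rw [pow_succ, pow_mul, Nat.mul_mod, Nat.pow_mod]; norm_num
      generalize 3 ^ (2 * r + 1) = b at *
      omega
    have : 2 ^ k ≤ 2 ^ 1 := Nat.pow_le_pow_right (by norm_num) (by omega)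
    omega

/-- A power of `3` dividing `2 ^ t - 1` is at most `(3 * t + 1) / 2`. -/
lemma three_pow_le_of_dvd_two_pow_sub_one {k t : ℕ} (ht : 0 < t) (h : 3 ^ k ∣ 2 ^ t - 1) :
    2 * 3 ^ k ≤ 3 * t + 1 := by
  have h1 : 1 < 2 ^ t := Nat.one_lt_pow ht.ne' (by norm_num)
  rcases Nat.even_or_odd' t with ⟨r, rfl | rfl⟩
  · have hr : 0 < r := by omega
    rw [pow_mul] at h h1
    have hv := padicValNat.pow_sub_pow (p := 3) (x := 2 ^ 2) (y := 1) (by norm_num) (by norm_num)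
      (by norm_num) (by norm_num) hr.ne'
    have h2 : padicValNat 3 (2 ^ 2 - 1) = 1 := by
      rw [show 2 ^ 2 - 1 = 3 by norm_num, padicValNat.self (by norm_num)]
    rw [h2, one_pow] at hv
    have hk : k ≤ padicValNat 3 ((2 ^ 2) ^ r - 1) :=
      (padicValNat_dvd_iff_le (by omega)).1 h
    have : 3 ^ k ≤ 3 * r :=
      calc 3 ^ k ≤ 3 ^ (1 + padicValNat 3 r) := Nat.pow_le_pow_right (by norm_num) (by omega)
        _ = 3 * 3 ^ padicValNat 3 r := by rw [pow_add]; norm_num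
        _ ≤ 3 * r := Nat.mul_le_mul_left 3 (Nat.le_of_dvd hr pow_padicValNat_dvd)
    omega
  · have hk : k = 0 := by
      by_contra hk
      have h3 : 3 ∣ 2 ^ (2 * r + 1) - 1 := (dvd_pow_self 3 hk).trans h
      have h9 : 2 ^ (2 * r + 1) % 3 = 2 := by
        rw [pow_succ, pow_mul, Nat.mul_mod, Nat.pow_mod]; norm_num
      omega
    subst hk
    omega

/-- Strictly larger powers of `b` are larger by a factor of at least `b`. -/
lemma mul_pow_le_pow_of_lt {b u v : ℕ} (hb : 0 < b) (h : u < v) : b * b ^ u ≤ b ^ v := by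
  rw [← pow_succ']
  exact Nat.pow_le_pow_right hb h

/-- A smaller power of `b` is either the next smaller one, or smaller by a factor `b ^ 2`. -/
lemma mul_pow_eq_or_le_of_lt {b u v : ℕ} (hb : 0 < b) (h : u < v) :
    b * b ^ u = b ^ v ∨ b ^ 2 * b ^ u ≤ b ^ v := by
  rcases (Nat.succ_le_of_lt h).eq_or_lt with rfl | h'
  · exact .inl (pow_succ' b u).symm
  · rw [← pow_add]
    exact .inr (Nat.pow_le_pow_right hb (by omega))

/-- If `j (3 ^ x - 3 ^ y) = i (2 ^ z - 2 ^ w)` with `j` odd, then `2 ^ w` is small. -/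
lemma two_pow_le_of_mul_sub_eq {i j x y z w : ℕ} (hj : Odd j) (hxy : y < x) (hwz : w < z)
    (h : j * (3 ^ x - 3 ^ y) = i * (2 ^ z - 2 ^ w)) : 2 ^ w ≤ 4 * (x - y) := by
  refine two_pow_le_of_dvd_three_pow_sub_one (by omega) ?_
  have h1 : 2 ^ w ∣ j * (3 ^ x - 3 ^ y) :=
    h ▸ Dvd.dvd.mul_left (Nat.dvd_sub (pow_dvd_pow 2 hwz.le) dvd_rfl) i
  have h2 : 3 ^ x - 3 ^ y = 3 ^ y * (3 ^ (x - y) - 1) := by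
    rw [Nat.mul_sub, ← pow_add, Nat.add_sub_cancel' hxy.le, mul_one]
  rw [h2] at h1
  exact (Nat.Coprime.pow_left w (by norm_num : Nat.Coprime 2 3)).pow_right y |>.dvd_of_dvd_mul_left
    ((Nat.Coprime.pow_left w hj.coprime_two_left).dvd_of_dvd_mul_left h1)

/-- If `j (3 ^ x - 3 ^ y) = i (2 ^ z - 2 ^ w)` with `i ∣ 3`, then `3 ^ y` is small. -/
lemma three_pow_le_of_mul_sub_eq {i j x y z w : ℕ} (hi : i ∣ 3) (hxy : y < x) (hwz : w < z)
    (h : j * (3 ^ x - 3 ^ y) = i * (2 ^ z - 2 ^ w)) : 2 * 3 ^ y ≤ 9 * (z - w) + 3 := by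
  have h1 : 3 ^ y ∣ i * (2 ^ z - 2 ^ w) :=
    h ▸ Dvd.dvd.mul_left (Nat.dvd_sub (pow_dvd_pow 3 hxy.le) dvd_rfl) j
  have h2 : 2 ^ z - 2 ^ w = 2 ^ w * (2 ^ (z - w) - 1) := by
    rw [Nat.mul_sub, ← pow_add, Nat.add_sub_cancel' hwz.le, mul_one]
  have h3 : 3 ^ y ∣ 3 * (2 ^ (z - w) - 1) := by
    have h4 := h1.trans (mul_dvd_mul_right hi _)
    rw [h2, mul_left_comm] at h4
    exact ((Nat.Coprime.pow_left y (by norm_num : Nat.Coprime 3 2)).pow_right w).dvd_of_dvd_mul_left h4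
  rcases y with _ | y
  · omega
  · rw [pow_succ'] at h3
    have := three_pow_le_of_dvd_two_pow_sub_one (by omega)
      (Nat.dvd_of_mul_dvd_mul_left (by norm_num) h3)
    rw [pow_succ']
    omega

/-- Two terms `2 ^ n + 3 ^ x > 2 ^ n + 3 ^ y` of the progression in positions `p > q ≥ 3`, `p ≤ 6`,
rule out a third one, `2 ^ n + 3 ^ u`, in position `1`. -/
lemma ne_of_two_dominated {a d n p q x y u v : ℕ} (hd : 0 < d) (hq : 3 ≤ q) (hp : p ≤ 6)
    (hxy : y < x) (hx : 2 ^ n + 3 ^ x = a + p * d) (hy : 2 ^ n + 3 ^ y = a + q * d)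
    (hu : a + 1 * d = 3 ^ u + 2 ^ v) : v ≠ n := by
  rintro rfl
  have h1 := mul_pow_le_pow_of_lt (b := 3) (by norm_num) hxy
  have h2 : 0 < 3 ^ u := by positivity
  have h3 := Nat.mul_le_mul_right d hq
  have h4 := Nat.mul_le_mul_right d hp
  omega

/-- Two terms `3 ^ m + 2 ^ z > 3 ^ m + 2 ^ w` of the progression in positions `p > q ≥ 3`, `p ≤ 6`,
rule out a third one, `3 ^ m + 2 ^ v`, in position `1`. -/
lemma ne_of_three_dominated {a d m p q z w u v : ℕ} (hd : 0 < d) (hq : 3 ≤ q) (hp : p ≤ 6)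
    (hwz : w < z) (hz : 3 ^ m + 2 ^ z = a + p * d) (hw : 3 ^ m + 2 ^ w = a + q * d)
    (hu : a + 1 * d = 3 ^ u + 2 ^ v) : u ≠ m := by
  rintro rfl
  have h1 := mul_pow_le_pow_of_lt (b := 2) (by norm_num) hwz
  have h2 : 0 < 2 ^ v := by positivity
  have h3 := Nat.mul_le_mul_right d hq
  have h4 := Nat.mul_le_mul_right d hp
  have hvw : v < w := by
    rw [← Nat.pow_lt_pow_iff_right (a := 2) (by norm_num)]
    omega
  obtain ⟨r, rfl⟩ := Nat.exists_eq_add_of_lt hvw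
  obtain ⟨s, rfl⟩ := Nat.exists_eq_add_of_lt hwz
  have hpq : q < p := by
    by_contra! hle
    have := Nat.mul_le_mul_right d hle
    omega
  have hp' : p = 6 ∧ q = 3 := by
    have hq6 : q < 6 := by omega
    interval_cases q <;> interval_cases p <;> omega
  obtain ⟨rfl, rfl⟩ := hp'
  have e1 : 2 ^ (v + r + 1) = 2 ^ v * (2 * 2 ^ r) := by ring
  have e2 : 2 ^ (v + r + 1 + s + 1) = 2 ^ v * (2 * (2 * 2 ^ (r + s))) := by ring
  rw [e1] at hw
  rw [e2] at hz
  have h5 : 2 ^ v * (2 * (2 * (2 * 2 ^ (r + s))) + 3) = 2 ^ v * (5 * (2 * 2 ^ r)) := by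
    linarith
  have h6 := Nat.eq_of_mul_eq_mul_left h2 h5
  omega

lemma mul_lt_two_pow {n : ℕ} (hn : 14 ≤ n) : 1150 * n < 2 ^ n := by
  induction n, hn using Nat.le_induction with
  | base => norm_num
  | succ k hk ih => rw [pow_succ]; omega

lemma mul_lt_three_pow {m : ℕ} (hm : 9 ≤ m) : 2150 * m < 3 ^ m := by
  induction m, hm using Nat.le_induction with
  | base => norm_num
  | succ k hk ih => rw [pow_succ]; omega

/-- The possible positions in the progression of the two 2-dominated and the two 3-dominated
terms. -/
lemma exists_positions {a d p q r s : ℕ} (hd : 0 < d) (hpq : q < p) (hrs : s < r)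
    (h : ({a + 6 * d, a + 5 * d, a + 4 * d, a + 3 * d} : Set ℕ) = {p, q, r, s}) :
    ∃ i j k l : ℕ, ((i, j, k, l) ∈ ({(6, 5, 4, 3), (4, 3, 6, 5), (6, 4, 5, 3), (5, 3, 6, 4),
      (6, 3, 5, 4), (5, 4, 6, 3)} : Finset (ℕ × ℕ × ℕ × ℕ))) ∧
      p = a + i * d ∧ q = a + j * d ∧ r = a + k * d ∧ s = a + l * d := by
  have key : ∀ b ∈ ({p, q, r, s} : Set ℕ), ∃ i, 3 ≤ i ∧ i ≤ 6 ∧ b = a + i * d := by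
    intro b hb
    rw [← h] at hb
    rcases hb with rfl | rfl | rfl | rfl
    exacts [⟨6, by simp⟩, ⟨5, by simp⟩, ⟨4, by simp⟩, ⟨3, by simp⟩]
  obtain ⟨i, hi, hi', rfl⟩ := key p (by simp)
  obtain ⟨j, hj, hj', rfl⟩ := key q (by simp)
  obtain ⟨k, hk, hk', rfl⟩ := key r (by simp)
  obtain ⟨l, hl, hl', rfl⟩ := key s (by simp)
  have mem : ∀ c : ℕ, a + c * d ∈ ({a + 6 * d, a + 5 * d, a + 4 * d, a + 3 * d} : Set ℕ) →
      c = i ∨ c = j ∨ c = k ∨ c = l := by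
    intro c hc
    rw [h] at hc
    simpa [hd.ne'] using hc
  have h6 := mem 6 (by simp)
  have h5 := mem 5 (by simp)
  have h4 := mem 4 (by simp)
  have h3 := mem 3 (by simp)
  have hij : j < i := by
    by_contra! hle
    have := Nat.mul_le_mul_right d hle
    omega
  have hkl : l < k := by
    by_contra! hle
    have := Nat.mul_le_mul_right d hle
    omega
  refine ⟨i, j, k, l, ?_, rfl, rfl, rfl, rfl⟩
  clear h mem key hpq hrs
  interval_cases i <;> interval_cases j <;> interval_cases k <;> interval_cases l <;>
    first | omega | simp

set_option maxHeartbeats 4000000 in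
/-- The equations and inequalities satisfied by the powers `X, Y, U` of `3` and `Z, W, V` of `2`
occurring in the progression are inconsistent. -/
lemma not_linear_system {a d e f i j k l X Y Z W U V : ℕ}
    (hmem : (i = 6 ∧ j = 5 ∧ k = 4 ∧ l = 3) ∨ (i = 4 ∧ j = 3 ∧ k = 6 ∧ l = 5) ∨
      (i = 6 ∧ j = 4 ∧ k = 5 ∧ l = 3) ∨ (i = 5 ∧ j = 3 ∧ k = 6 ∧ l = 4) ∨
      (i = 6 ∧ j = 3 ∧ k = 5 ∧ l = 4) ∨ (i = 5 ∧ j = 4 ∧ k = 6 ∧ l = 3))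
    (he : e < 4) (hf : f < 5) (hd : 0 < d)
    (hY : 240 * Y ≤ Z * 2 ^ f) (hW : 530 * W ≤ X * 3 ^ e)
    (hm₁ : X * 3 ^ e ≤ a + 6 * d) (hm₂ : a + 6 * d < X * 3 ^ e * 3)
    (hn₁ : Z * 2 ^ f ≤ a + 6 * d) (hn₂ : a + 6 * d < Z * 2 ^ f * 2)
    (hi : Z * 2 ^ f + X = a + i * d) (hj : Z * 2 ^ f + Y = a + j * d)
    (hk : X * 3 ^ e + Z = a + k * d) (hl : X * 3 ^ e + W = a + l * d)
    (ha : a + 1 * d = U + V)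
    (hU : 3 * U = X * 3 ^ e ∨ 3 ^ 2 * U ≤ X * 3 ^ e)
    (hV : 2 * V = Z * 2 ^ f ∨ 2 ^ 2 * V ≤ Z * 2 ^ f) : False := by
  rcases hmem with ⟨rfl, rfl, rfl, rfl⟩ | ⟨rfl, rfl, rfl, rfl⟩ | ⟨rfl, rfl, rfl, rfl⟩ |
    ⟨rfl, rfl, rfl, rfl⟩ | ⟨rfl, rfl, rfl, rfl⟩ | ⟨rfl, rfl, rfl, rfl⟩ <;>
  interval_cases e <;> interval_cases f <;> omega

theorem no_two_two_split (a d m n : ℕ)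
    (ha : 0 < a) (hd : 0 < d)
    (hAP : ∀ i : ℕ, i ≤ 6 → ∃ x y : ℕ, a + i * d = 3 ^ x + 2 ^ y)
    (hbig : 3 ^ 9 ≤ a + 6 * d)
    (hm₁ : 3 ^ m ≤ a + 6 * d) (hm₂ : a + 6 * d < 3 ^ (m + 1))
    (hn₁ : 2 ^ n ≤ a + 6 * d) (hn₂ : a + 6 * d < 2 ^ (n + 1)) :
    ¬ ∃ x y z w : ℕ, y < x ∧ w < z ∧
      ({a + 6 * d, a + 5 * d, a + 4 * d, a + 3 * d} : Set ℕ) =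
        {2 ^ n + 3 ^ x, 2 ^ n + 3 ^ y, 3 ^ m + 2 ^ z, 3 ^ m + 2 ^ w} := by
  rintro ⟨x, y, z, w, hxy, hwz, hset⟩
  have hxy' : 3 ^ y < 3 ^ x := Nat.pow_lt_pow_right (by norm_num) hxy
  have hwz' : 2 ^ w < 2 ^ z := Nat.pow_lt_pow_right (by norm_num) hwz
  obtain ⟨i, j, k, l, hmem, hi, hj, hk, hl⟩ :=
    exists_positions hd (by omega) (by omega) hset
  simp only [Finset.mem_insert, Finset.mem_singleton, Prod.mk.injEq] at hmem
  obtain ⟨u, v, huv⟩ := hAP 1 (by norm_num)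
  have hu0 : 0 < 3 ^ u := by positivity
  have hv0 : 0 < 2 ^ v := by positivity
  have hy0 : 0 < 3 ^ y := by positivity
  have hw0 : 0 < 2 ^ w := by positivity
  have hvn := ne_of_two_dominated hd (by omega) (by omega) hxy hi hj huv
  have hum := ne_of_three_dominated hd (by omega) (by omega) hwz hk hl huv
  have hm9 : 9 ≤ m := by
    have : 3 ^ 9 < 3 ^ (m + 1) := by omega
    have := (Nat.pow_lt_pow_iff_right (by norm_num)).1 this
    omega
  have hn14 : 14 ≤ n := by
    have : 2 ^ 14 < 2 ^ (n + 1) := by omega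
    have := (Nat.pow_lt_pow_iff_right (by norm_num)).1 this
    omega
  have hle : ∀ c : ℕ, c ≤ 6 → c * d ≤ 6 * d := fun c hc => Nat.mul_le_mul_right d hc
  have hi6 := hle i (by omega)
  have hk6 := hle k (by omega)
  have hxm : x ≤ m := by
    have : 3 ^ x < 3 ^ (m + 1) := by omega
    have := (Nat.pow_lt_pow_iff_right (by norm_num)).1 this
    omega
  have hzn : z ≤ n := by
    have : 2 ^ z < 2 ^ (n + 1) := by omega
    have := (Nat.pow_lt_pow_iff_right (by norm_num)).1 this
    omega
  have hu : u < m := by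
    have : 3 ^ u < 3 ^ (m + 1) := by omega
    have := (Nat.pow_lt_pow_iff_right (by norm_num)).1 this
    omega
  have hv : v < n := by
    have : 2 ^ v < 2 ^ (n + 1) := by omega
    have := (Nat.pow_lt_pow_iff_right (by norm_num)).1 this
    omega
  have hu' := mul_pow_eq_or_le_of_lt (b := 3) (by norm_num) hu
  have hv' := mul_pow_eq_or_le_of_lt (b := 2) (by norm_num) hv
  have hsmall : 2 ^ w ≤ 4 * (x - y) ∧ 2 * 3 ^ y ≤ 9 * (z - w) + 3 := by
    have : (1 * (3 ^ x - 3 ^ y) = 1 * (2 ^ z - 2 ^ w)) ∨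
        (1 * (3 ^ x - 3 ^ y) = 3 * (2 ^ z - 2 ^ w)) ∨
        (3 * (3 ^ x - 3 ^ y) = 1 * (2 ^ z - 2 ^ w)) := by
      rcases hmem with ⟨rfl, rfl, rfl, rfl⟩ | ⟨rfl, rfl, rfl, rfl⟩ | ⟨rfl, rfl, rfl, rfl⟩ |
        ⟨rfl, rfl, rfl, rfl⟩ | ⟨rfl, rfl, rfl, rfl⟩ | ⟨rfl, rfl, rfl, rfl⟩ <;> omega
    rcases this with h | h | h <;>
      exact ⟨two_pow_le_of_mul_sub_eq (by decide) hxy hwz h,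
        three_pow_le_of_mul_sub_eq (by norm_num) hxy hwz h⟩
  have hn' := mul_lt_two_pow hn14
  have hm' := mul_lt_three_pow hm9
  have hW : 530 * 2 ^ w ≤ 3 ^ m := by omega
  have hY : 240 * 3 ^ y ≤ 2 ^ n := by omega
  rw [pow_succ] at hm₂ hn₂
  obtain ⟨e, rfl⟩ := Nat.exists_eq_add_of_le hxm
  obtain ⟨f, rfl⟩ := Nat.exists_eq_add_of_le hzn
  have hdx : d ≤ 3 ^ x := by
    rcases hmem with ⟨rfl, rfl, rfl, rfl⟩ | ⟨rfl, rfl, rfl, rfl⟩ | ⟨rfl, rfl, rfl, rfl⟩ |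
      ⟨rfl, rfl, rfl, rfl⟩ | ⟨rfl, rfl, rfl, rfl⟩ | ⟨rfl, rfl, rfl, rfl⟩ <;> omega
  have hdz : d ≤ 2 ^ z := by
    rcases hmem with ⟨rfl, rfl, rfl, rfl⟩ | ⟨rfl, rfl, rfl, rfl⟩ | ⟨rfl, rfl, rfl, rfl⟩ |
      ⟨rfl, rfl, rfl, rfl⟩ | ⟨rfl, rfl, rfl, rfl⟩ | ⟨rfl, rfl, rfl, rfl⟩ <;> omega
  have he : e < 4 := by
    by_contra! h
    have := Nat.mul_le_mul_left (3 ^ x) (Nat.pow_le_pow_right (n := 3) (by norm_num) h)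
    rw [← pow_add 3 x e] at this
    omega
  have hf : f < 5 := by
    by_contra! h
    have := Nat.mul_le_mul_left (2 ^ z) (Nat.pow_le_pow_right (n := 2) (by norm_num) h)
    rw [← pow_add 2 z f] at this
    omega
  rw [pow_add 3 x e] at *
  rw [pow_add 2 z f] at *
  exact not_linear_system hmem he hf hd hY hW hm₁ hm₂ hn₁ hn₂ hi hj hk hl huv hu' hv'
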